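/- arXiv:1705.10461 — 4 statements merged into one kernel-verified Lean document; each statement's English description precedes it below -/
import Mathlib

section
/- Let M ∈ ℝ^{n×n} be negative semi-definite (wᵀ M w ≤ 0 for all w ∈ ℝⁿ) and invertible, and let γ > 0. Then the matrix (I − γ·Mᵀ)·M is negative definite, i.e. wᵀ (I − γ Mᵀ) M w < 0 for all nonzero w ∈ ℝⁿ. -/
open Matrix

/-- If `M` is negative semi-definite and invertible and `γ > 0`, then
`(I − γ·Mᵀ)·M` is negative definite. -/
theorem precond_negdef {n : ℕ} (M : Matrix (Fin n) (Fin n) ℝ)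
    (hnsd : ∀ w : Fin n → ℝ, w ⬝ᵥ M.mulVec w ≤ 0) (hinv : IsUnit M)
    (γ : ℝ) (hγ : 0 < γ) :
    ∀ w : Fin n → ℝ, w ≠ 0 → w ⬝ᵥ ((1 - γ • Mᵀ) * M).mulVec w < 0 := by
  intro w hw
  have hMw : M.mulVec w ≠ 0 := fun h =>
    hw (Matrix.mulVec_injective_of_isUnit hinv (h.trans (Matrix.mulVec_zero M).symm))
  have hpos : 0 < M.mulVec w ⬝ᵥ M.mulVec w :=
    lt_of_le_of_ne (Finset.sum_nonneg fun i _ => mul_self_nonneg _)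
      fun h => hMw (dotProduct_self_eq_zero.mp h.symm)
  have hexp : w ⬝ᵥ ((1 - γ • Mᵀ) * M).mulVec w =
      w ⬝ᵥ M.mulVec w - γ * (M.mulVec w ⬝ᵥ M.mulVec w) := by
    rw [← Matrix.mulVec_mulVec, Matrix.sub_mulVec, Matrix.one_mulVec, Matrix.smul_mulVec,
      dotProduct_sub, dotProduct_smul, Matrix.dotProduct_mulVec w Mᵀ, Matrix.vecMul_transpose,
      smul_eq_mul]
  rw [hexp]
  linarith [hnsd w, mul_pos hγ hpos]
end

section
/- Let v: ℝⁿ → ℝⁿ be continuously differentiable with v(x̄) = 0, and suppose the Jacobian matrix v′(x̄) is negative semi-definite (wᵀ v′(x̄) w ≤ 0 for all w) and invertible. Let γ > 0 and define F(x) = x + h·(I − γ·v′(x)ᵀ)·v(x). Then for all sufficiently small h > 0 there is an open neighborhood U of x̄ such that for all x₀ ∈ U the iterates F^{(k)}(x₀) converge to x̄ as k → ∞. -/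
open Matrix Filter Topology

/-- If `C` is continuous at `a` and `V` vanishes at `a`, the product rule for `x ↦ C x (V x)` at `a`
does not need differentiability of `C`. -/
theorem HasFDerivAt.clm_apply_of_eq_zero {E F H : Type*} [NormedAddCommGroup E] [NormedSpace ℝ E]
    [NormedAddCommGroup F] [NormedSpace ℝ F] [NormedAddCommGroup H] [NormedSpace ℝ H]
    {C : E → F →L[ℝ] H} {V : E → F} {A : E →L[ℝ] F} {a : E}
    (hV : HasFDerivAt V A a) (hC : ContinuousAt C a) (h0 : V a = 0) :
    HasFDerivAt (fun x => C x (V x)) ((C a).comp A) a := by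
  have h1 : HasFDerivAt (fun x => C a (V x)) ((C a).comp A) a := (C a).hasFDerivAt.comp a hV
  have h2 : HasFDerivAt (fun x => (C x - C a) (V x)) (0 : E →L[ℝ] H) a := by
    rw [hasFDerivAt_iff_isLittleO]
    have hVO : V =O[𝓝 a] fun x => x - a := by simpa [h0] using hV.isBigO_sub
    have hCo : (fun x => C x - C a) =o[𝓝 a] fun _ => (1 : ℝ) := by
      rw [Asymptotics.isLittleO_one_iff]
      simpa using hC.sub_const (C a)
    have hprod := hCo.norm_left.mul_isBigO hVO.norm_norm
    simp only [one_mul] at hprod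
    have hle : (fun x => (C x - C a) (V x)) =O[𝓝 a] fun x => ‖C x - C a‖ * ‖V x‖ :=
      Asymptotics.isBigO_of_le _ fun x => by
        simpa only [norm_mul, norm_norm] using (C x - C a).le_opNorm (V x)
    simpa [h0] using (hle.trans_isLittleO hprod).of_norm_right
  simpa using (h1.add h2).congr_of_eventuallyEq (f₁ := fun x => C x (V x))
    (Eventually.of_forall fun x => by simp)

/-- A negative definite operator on a finite-dimensional space is uniformly negative definite. -/
theorem exists_pos_inner_le_neg_mul_norm_sq {E : Type*} [NormedAddCommGroup E]
    [InnerProductSpace ℝ E] [FiniteDimensional ℝ E] (M : E →L[ℝ] E)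
    (hM : ∀ w, w ≠ 0 → inner ℝ w (M w) < 0) :
    ∃ c > (0 : ℝ), ∀ w, inner ℝ w (M w) ≤ -c * ‖w‖ ^ 2 := by
  obtain hE | hE := subsingleton_or_nontrivial E
  · exact ⟨1, one_pos, fun w => by simp [Subsingleton.elim w 0]⟩
  have hne : (Metric.sphere (0 : E) 1).Nonempty := NormedSpace.sphere_nonempty.2 zero_le_one
  obtain ⟨u, hu, hmax⟩ := (isCompact_sphere (0 : E) 1).exists_isMaxOn hne
    (f := fun w => inner ℝ w (M w)) (by fun_prop)
  have hu0 : u ≠ 0 := by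
    rintro rfl
    simp at hu
  refine ⟨-inner ℝ u (M u), neg_pos.2 (hM u hu0), fun w => ?_⟩
  obtain rfl | hw := eq_or_ne w 0
  · simp
  have hw' : 0 < ‖w‖ := norm_pos_iff.2 hw
  have hmem : ‖w‖⁻¹ • w ∈ Metric.sphere (0 : E) 1 := by
    simp [norm_smul, hw'.ne']
  have hle : inner ℝ (‖w‖⁻¹ • w) (M (‖w‖⁻¹ • w)) ≤ inner ℝ u (M u) := hmax hmem
  rw [map_smul, real_inner_smul_left, real_inner_smul_right] at hle
  calc inner ℝ w (M w) = (‖w‖⁻¹ * (‖w‖⁻¹ * inner ℝ w (M w))) * ‖w‖ ^ 2 := by field_simp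
    _ ≤ inner ℝ u (M u) * ‖w‖ ^ 2 := by gcongr
    _ = _ := by ring

/-- The explicit Euler iteration with small step size converges locally to a zero of the vector
field at which the derivative is uniformly negative definite. -/
theorem exists_step_forall_tendsto_iterate {E : Type*} [NormedAddCommGroup E]
    [InnerProductSpace ℝ E] {G : E → E} {M : E →L[ℝ] E} {a : E} (hG : HasFDerivAt G M a)
    (h0 : G a = 0) {c : ℝ} (hc : 0 < c) (hM : ∀ w, inner ℝ w (M w) ≤ -c * ‖w‖ ^ 2) :
    ∃ h₀ > (0 : ℝ), ∀ h : ℝ, 0 < h → h < h₀ → ∃ U : Set E, IsOpen U ∧ a ∈ U ∧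
      ∀ x₀ ∈ U, Tendsto (fun k => (fun x => x + h • G x)^[k] x₀) atTop (𝓝 a) := by
  have hev := hG.isLittleO.def (half_pos hc)
  simp only [h0, sub_zero] at hev
  obtain ⟨r, hr, hball⟩ := Metric.eventually_nhds_iff_ball.1 hev
  set K : ℝ := ‖M‖ + c with hK
  have hcK : c ≤ K := by simp [hK]
  have hK0 : 0 < K := hc.trans_le hcK
  refine ⟨c / K ^ 2, by positivity, fun h hh hh0 =>
    ⟨Metric.ball a r, Metric.isOpen_ball, Metric.mem_ball_self hr, fun x₀ hx₀ => ?_⟩⟩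
  rw [lt_div_iff₀ (by positivity)] at hh0
  set ρ : ℝ := 1 - h * c + h ^ 2 * K ^ 2 with hρ
  have hρ1 : ρ < 1 := by nlinarith
  have hρ0 : 0 ≤ ρ := by
    have : h ^ 2 * c ^ 2 ≤ h ^ 2 * K ^ 2 := by gcongr
    nlinarith [sq_nonneg (h * c - 1), sq_nonneg (h * c)]
  have hstep : ∀ x ∈ Metric.ball a r, ‖x + h • G x - a‖ ^ 2 ≤ ρ * ‖x - a‖ ^ 2 := by
    intro x hx
    have hb := hball x hx
    set w := x - a
    set R := G x - M w with hR
    have hGx : G x = M w + R := by simp [hR]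
    have hnorm : ‖G x‖ ≤ K * ‖w‖ := by
      calc ‖G x‖ ≤ ‖M w‖ + ‖R‖ := hGx ▸ norm_add_le _ _
        _ ≤ ‖M‖ * ‖w‖ + c / 2 * ‖w‖ := add_le_add (M.le_opNorm w) hb
        _ ≤ K * ‖w‖ := by nlinarith [norm_nonneg w]
    have hsq : ‖G x‖ ^ 2 ≤ K ^ 2 * ‖w‖ ^ 2 := by
      rw [← mul_pow]
      gcongr
    have hinner : inner ℝ w (G x) ≤ -(c / 2) * ‖w‖ ^ 2 := by
      rw [hGx, inner_add_right]
      nlinarith [hM w, real_inner_le_norm w R, mul_le_mul_of_nonneg_left hb (norm_nonneg w)]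
    have hexp : ‖x + h • G x - a‖ ^ 2
        = ‖w‖ ^ 2 + 2 * (h * inner ℝ w (G x)) + h ^ 2 * ‖G x‖ ^ 2 := by
      rw [add_sub_right_comm, norm_add_sq_real, real_inner_smul_right, norm_smul, mul_pow,
        Real.norm_eq_abs, sq_abs]
    rw [hexp, hρ]
    nlinarith [mul_le_mul_of_nonneg_left hinner hh.le,
      mul_le_mul_of_nonneg_left hsq (sq_nonneg h)]
  have hiter : ∀ k : ℕ, (fun x => x + h • G x)^[k] x₀ ∈ Metric.ball a r ∧
      ‖(fun x => x + h • G x)^[k] x₀ - a‖ ^ 2 ≤ ρ ^ k * ‖x₀ - a‖ ^ 2 := by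
    intro k
    induction k with
    | zero => simpa using hx₀
    | succ k ih =>
      obtain ⟨hmem, hle⟩ := ih
      rw [Function.iterate_succ_apply']
      set y := (fun x => x + h • G x)^[k] x₀
      have hy := hstep y hmem
      refine ⟨?_, ?_⟩
      · rw [mem_ball_iff_norm] at hmem ⊢
        refine ((sq_le_sq₀ (norm_nonneg _) (norm_nonneg _)).1 ?_).trans_lt hmem
        nlinarith [sq_nonneg ‖y - a‖]
      · calc _ ≤ ρ * ‖y - a‖ ^ 2 := hy
          _ ≤ ρ * (ρ ^ k * ‖x₀ - a‖ ^ 2) := by gcongr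
          _ = _ := by ring
  rw [tendsto_iff_norm_sub_tendsto_zero]
  have hsq : Tendsto (fun k => ‖(fun x => x + h • G x)^[k] x₀ - a‖ ^ 2) atTop (𝓝 0) :=
    squeeze_zero (fun k => sq_nonneg _) (fun k => (hiter k).2)
      (by simpa using (tendsto_pow_atTop_nhds_zero_of_lt_one hρ0 hρ1).mul_const (‖x₀ - a‖ ^ 2))
  simpa [Real.sqrt_sq] using hsq.sqrt

/-- Convergence of the explicit Euler iteration in coordinates. -/
theorem exists_step_forall_tendsto_iterate_pi {n : ℕ} {G : (Fin n → ℝ) → Fin n → ℝ}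
    {M : Matrix (Fin n) (Fin n) ℝ} {a : Fin n → ℝ}
    (hG : HasFDerivAt G M.mulVecLin.toContinuousLinearMap a) (h0 : G a = 0)
    (hM : ∀ w, w ≠ 0 → w ⬝ᵥ M *ᵥ w < 0) :
    ∃ h₀ > (0 : ℝ), ∀ h : ℝ, 0 < h → h < h₀ → ∃ U : Set (Fin n → ℝ), IsOpen U ∧ a ∈ U ∧
      ∀ x₀ ∈ U, Tendsto (fun k => (fun x => x + h • G x)^[k] x₀) atTop (𝓝 a) := by
  let e := EuclideanSpace.equiv (Fin n) ℝ
  let G' : EuclideanSpace ℝ (Fin n) → EuclideanSpace ℝ (Fin n) := fun x => e.symm (G (e x))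
  let M' : EuclideanSpace ℝ (Fin n) →L[ℝ] EuclideanSpace ℝ (Fin n) :=
    (e.symm : _ →L[ℝ] _).comp ((M.mulVecLin.toContinuousLinearMap).comp (e : _ →L[ℝ] _))
  have hG' : HasFDerivAt G' M' (e.symm a) := by
    refine e.symm.hasFDerivAt.comp _ (HasFDerivAt.comp (e.symm a) (g := G) ?_ e.hasFDerivAt)
    simpa using hG
  have hM' : ∀ w, w ≠ 0 → inner ℝ w (M' w) < 0 := by
    intro w hw
    have := hM (e w) (by simpa using hw)
    rw [EuclideanSpace.inner_eq_star_dotProduct, dotProduct_comm]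
    exact this
  obtain ⟨c, hc, hcM⟩ := exists_pos_inner_le_neg_mul_norm_sq M' hM'
  obtain ⟨h₀, hh₀, H⟩ := exists_step_forall_tendsto_iterate hG' (by simp [G', h0]) hc hcM
  refine ⟨h₀, hh₀, fun h hh hlt => ?_⟩
  obtain ⟨U, hU, haU, hconv⟩ := H h hh hlt
  refine ⟨e.symm ⁻¹' U, hU.preimage e.symm.continuous, haU, fun x₀ hx₀ => ?_⟩
  have hsemi : Function.Semiconj e (fun x => x + h • G' x) (fun x => x + h • G x) := fun x => by
    simp [G']
  have hlim := (e.continuous.tendsto _).comp (hconv _ hx₀)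
  rw [e.apply_symm_apply] at hlim
  refine hlim.congr fun k => ?_
  simpa using (hsemi.iterate_right k).eq (e.symm x₀)

/-- Local convergence of consensus optimization: if `v` is `C²` with Jacobian
matrix `J x` at every `x`, `v(x̄) = 0`, `v′(x̄)` is negative semi-definite and
invertible, and `γ > 0`, then for all sufficiently small `h > 0` the iteration
`F(x) = x + h·(I − γ·v′(x)ᵀ)·v(x)` is locally convergent to `x̄`. -/
theorem consensus_locally_convergent {n : ℕ} (v : (Fin n → ℝ) → (Fin n → ℝ))
    (xbar : Fin n → ℝ) (γ : ℝ) (hγ : 0 < γ) (hv : ContDiff ℝ 2 v)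
    (hstat : v xbar = 0)
    (J : (Fin n → ℝ) → Matrix (Fin n) (Fin n) ℝ)
    (hJ : ∀ x, HasFDerivAt v (J x).mulVecLin.toContinuousLinearMap x)
    (hnsd : ∀ w : Fin n → ℝ, w ⬝ᵥ (J xbar).mulVec w ≤ 0)
    (hinv : IsUnit (J xbar)) :
    ∃ h₀ > (0 : ℝ), ∀ h : ℝ, 0 < h → h < h₀ →
      ∃ U : Set (Fin n → ℝ), IsOpen U ∧ xbar ∈ U ∧
        ∀ x₀ ∈ U, Tendsto
          (fun k => (fun x => x + h • (((1 : Matrix (Fin n) (Fin n) ℝ) - γ • (J x)ᵀ).mulVec (v x)))^[k] x₀)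
          atTop (𝓝 xbar) := by
  have hJc : Continuous J := by
    refine continuous_matrix fun i j => ?_
    have hJe : (fun x => J x i j) = fun x => fderiv ℝ v x (Pi.single j 1) i := by
      funext x
      simp [(hJ x).fderiv]
    have hfd : Continuous (fderiv ℝ v) := hv.continuous_fderiv (by norm_num)
    rw [hJe]
    exact (continuous_apply i).comp (hfd.clm_apply continuous_const)
  let L : Matrix (Fin n) (Fin n) ℝ →ₗ[ℝ] (Fin n → ℝ) →L[ℝ] (Fin n → ℝ) :=
    LinearMap.toContinuousLinearMap.toLinearMap ∘ₗ Matrix.toLin'.toLinearMap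
  have hL : Continuous L := L.continuous_of_finiteDimensional
  have hC : Continuous fun x => L (1 - γ • (J x)ᵀ) := by fun_prop
  have hG := (hJ xbar).clm_apply_of_eq_zero hC.continuousAt hstat
  refine exists_step_forall_tendsto_iterate_pi (M := (1 - γ • (J xbar)ᵀ) * J xbar)
    (G := fun x => ((1 : Matrix (Fin n) (Fin n) ℝ) - γ • (J x)ᵀ) *ᵥ v x)
    ?_ (by simp [hstat]) fun w hw => ?_
  · have hM : ((1 - γ • (J xbar)ᵀ) * J xbar).mulVecLin.toContinuousLinearMap
        = (L (1 - γ • (J xbar)ᵀ)).comp (J xbar).mulVecLin.toContinuousLinearMap :=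
      ContinuousLinearMap.ext fun w => (Matrix.mulVec_mulVec w _ _).symm
    rw [hM]
    exact hG
  · have hne : J xbar *ᵥ w ≠ 0 := fun h =>
      hw (Matrix.mulVec_injective_of_isUnit hinv (by simpa using h))
    have hpos : 0 < J xbar *ᵥ w ⬝ᵥ J xbar *ᵥ w :=
      lt_of_le_of_ne (Finset.sum_nonneg fun i _ => mul_self_nonneg _)
        (Ne.symm (mt dotProduct_self_eq_zero.1 hne))
    have hexp : w ⬝ᵥ ((1 - γ • (J xbar)ᵀ) * J xbar) *ᵥ w
        = w ⬝ᵥ J xbar *ᵥ w - γ * (J xbar *ᵥ w ⬝ᵥ J xbar *ᵥ w) := by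
      rw [← Matrix.mulVec_mulVec, Matrix.sub_mulVec, Matrix.one_mulVec, Matrix.smul_mulVec,
        dotProduct_sub, dotProduct_smul, Matrix.dotProduct_mulVec w (J xbar)ᵀ,
        Matrix.vecMul_transpose, smul_eq_mul]
    rw [hexp]
    nlinarith [hnsd w, mul_pos hγ hpos]
end

section
/- Let M ∈ ℝ^{n×n}, γ ∈ ℝ, and form the block matrix J = [[0, I], [M, −γI]] ∈ ℝ^{2n×2n}. Then a complex number λ is an eigenvalue of J if and only if λ(λ + γ) is an eigenvalue of M. -/
open Matrix

section CommRing

variable {m R : Type*} [Fintype m] [DecidableEq m] [CommRing R]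

theorem Matrix.isUnit_fromBlocks_scalar_iff (A : Matrix m m R) (a b : R) :
    IsUnit (fromBlocks (a • 1) (-1) (-A) (b • 1) : Matrix (m ⊕ m) (m ⊕ m) R) ↔
      IsUnit ((a * b) • 1 - A) := by
  have factor : (fromBlocks (a • 1) (-1) (-A) (b • 1) : Matrix (m ⊕ m) (m ⊕ m) R) =
      fromBlocks 0 (-1) 1 (b • 1) * fromBlocks ((a * b) • 1 - A) 0 0 1 *
        fromBlocks 1 0 (-(a • 1)) 1 := by
    simp [fromBlocks_multiply, smul_smul]
    abel
  have left : IsUnit (fromBlocks 0 (-1) 1 (b • 1) : Matrix (m ⊕ m) (m ⊕ m) R) := by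
    refine IsUnit.of_mul_eq_one (fromBlocks (b • 1) 1 (-1) 0) ?_
    simp [fromBlocks_multiply]
  rw [isUnit_iff_isUnit_det] at left
  rw [factor, isUnit_iff_isUnit_det, det_mul, det_mul]
  simp [left, isUnit_iff_isUnit_det]

theorem Matrix.mem_spectrum_fromBlocks_zero_one_iff (A : Matrix m m R) (c r : R) :
    r ∈ spectrum R (fromBlocks 0 1 A (-c • 1) : Matrix (m ⊕ m) (m ⊕ m) R) ↔
      r * (r + c) ∈ spectrum R A := by
  rw [spectrum.mem_iff, spectrum.mem_iff, Algebra.algebraMap_eq_smul_one,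
    Algebra.algebraMap_eq_smul_one, ← isUnit_fromBlocks_scalar_iff, ← fromBlocks_one,
    fromBlocks_smul, sub_eq_add_neg, fromBlocks_neg, fromBlocks_add]
  simp [add_smul]

end CommRing


/-- For the momentum Jacobian `J = [[0, I], [M, −γI]]`, `λ` is an eigenvalue of
`J` iff `λ(λ + γ)` is an eigenvalue of `M`. -/
theorem momentum_block_eigenvalue_iff {n : ℕ} (M : Matrix (Fin n) (Fin n) ℝ)
    (γ : ℝ) (lam : ℂ) :
    lam ∈ spectrum ℂ
        ((Matrix.fromBlocks (0 : Matrix (Fin n) (Fin n) ℝ) (1 : Matrix (Fin n) (Fin n) ℝ)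
            M (-γ • (1 : Matrix (Fin n) (Fin n) ℝ))).map (Complex.ofReal ·)) ↔
      lam * (lam + (γ : ℂ)) ∈ spectrum ℂ (M.map (Complex.ofReal ·)) := by
  rw [← mem_spectrum_fromBlocks_zero_one_iff, fromBlocks_map,
    show (-γ • (1 : Matrix (Fin n) (Fin n) ℝ)).map (Complex.ofReal ·) = -(γ : ℂ) • 1 by
      ext i j; by_cases h : i = j <;> simp [h],
    Matrix.map_zero _ Complex.ofReal_zero,
    Matrix.map_one _ Complex.ofReal_zero Complex.ofReal_one]
end

section
/- Let G₁, G₂: ℝⁿ → ℝⁿ be continuously differentiable with G₁(x̄) = 0 and G₂(x̄) = 0, and suppose all (complex) eigenvalues of the matrix G₁′(x̄) + G₂′(x̄) have negative real part. Then for all sufficiently small h > 0, the composed iteration F = (id + h·G₂) ∘ (id + h·G₁) is locally convergent to x̄: there is an open neighborhood U of x̄ such that for all x₀ ∈ U the iterates F^{(k)}(x₀) converge to x̄ as k → ∞. -/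
open Matrix Filter Topology

/-- If every spectral value of `a` lies in the open unit disc, then some positive power of `a` is a
strict contraction. -/
theorem exists_norm_pow_lt_one_of_spectrum {A : Type*} [NormedRing A] [NormedAlgebra ℂ A]
    [CompleteSpace A] (a : A) (ha : ∀ z ∈ spectrum ℂ a, ‖z‖ < 1) :
    ∃ N : ℕ, 0 < N ∧ ‖a ^ N‖ < 1 := by
  rcases subsingleton_or_nontrivial A with hA | hA
  · exact ⟨1, one_pos, by simp [Subsingleton.elim a 0]⟩
  have hr : spectralRadius ℂ a < 1 := by
    simpa using spectrum.spectralRadius_lt_of_forall_lt (r := 1) a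
      fun z hz => by simpa [← NNReal.coe_lt_coe] using ha z hz
  have hlim := spectrum.pow_nnnorm_pow_one_div_tendsto_nhds_spectralRadius a
  obtain ⟨N, hN, hN0⟩ := ((hlim.eventually_lt_const hr).and (eventually_gt_atTop 0)).exists
  refine ⟨N, hN0, ?_⟩
  by_contra! hge
  have hge' : (1 : ENNReal) ≤ ‖a ^ N‖₊ := by exact_mod_cast hge
  exact absurd hN (not_lt.mpr (ENNReal.one_le_rpow hge' (by positivity)))

/-- If the spectrum of `a` lies in the open left half-plane, then for all small `h > 0` the spectrum
of `1 + h • (a + h • b)` lies in the open unit disc. -/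
theorem eventually_spectrum_one_add_smul_norm_lt_one {A : Type*} [NormedRing A]
    [NormedAlgebra ℂ A] [CompleteSpace A] (a b : A) (ha : ∀ z ∈ spectrum ℂ a, z.re < 0) :
    ∀ᶠ h : ℝ in 𝓝[>] 0, ∀ z ∈ spectrum ℂ (1 + (h : ℂ) • (a + (h : ℂ) • b)), ‖z‖ < 1 := by
  set C : ℝ := (‖a‖ + ‖b‖) * ‖(1 : A)‖
  have key : ∀ᶠ h : ℝ in 𝓝 0, ∀ z ∈ Metric.closedBall (0 : ℂ) C,
      IsUnit (algebraMap ℂ A z - (a + (h : ℂ) • b)) ∨ 2 * z.re + h * ‖z‖ ^ 2 < 0 := by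
    refine (isCompact_closedBall (0 : ℂ) C).eventually_forall_of_forall_eventually
      fun z _ => ?_
    by_cases hz : z ∈ spectrum ℂ a
    · have hc : Continuous fun p : ℝ × ℂ => 2 * p.2.re + p.1 * ‖p.2‖ ^ 2 := by fun_prop
      filter_upwards [hc.continuousAt.eventually_lt_const
        (show 2 * z.re + 0 * ‖z‖ ^ 2 < 0 by linarith [ha z hz])] with p hp using Or.inr hp
    · have hc : Continuous fun p : ℝ × ℂ => algebraMap ℂ A p.2 - (a + (p.1 : ℂ) • b) := by
        fun_prop
      have hu : IsUnit (algebraMap ℂ A z - (a + ((0 : ℝ) : ℂ) • b)) := by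
        simpa [spectrum.mem_iff] using hz
      filter_upwards [hc.continuousAt.preimage_mem_nhds (Units.isOpen.mem_nhds hu)]
        with p hp using Or.inl hp
  filter_upwards [nhdsWithin_le_nhds key, self_mem_nhdsWithin,
    nhdsWithin_le_nhds (Iio_mem_nhds (show (0 : ℝ) < 1 by norm_num))] with h hkey hpos hlt z hz
  have hpos' : 0 < h := hpos
  have hlt' : h < 1 := hlt
  have hne : (h : ℂ) ≠ 0 := by exact_mod_cast hpos'.ne'
  obtain ⟨w, rfl⟩ : ∃ w : ℂ, z = 1 + h * w := ⟨(z - 1) / h, by field_simp; ring⟩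
  have hw : w ∈ spectrum ℂ (a + (h : ℂ) • b) := by
    rw [spectrum.mem_iff] at hz ⊢
    intro hu
    refine hz ?_
    have := hu.smul (Units.mk0 (h : ℂ) hne)
    convert this using 1
    simp [Units.smul_def, Algebra.algebraMap_eq_smul_one, smul_sub, add_smul, mul_smul]
  have hwC : ‖w‖ ≤ C := by
    refine (spectrum.norm_le_norm_mul_of_mem hw).trans ?_
    refine mul_le_mul_of_nonneg_right ((norm_add_le _ _).trans ?_) (norm_nonneg _)
    gcongr
    rw [norm_smul, Complex.norm_real, Real.norm_of_nonneg hpos'.le]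
    exact mul_le_of_le_one_left (norm_nonneg _) hlt'.le
  rcases hkey w (by simpa using hwC) with hu | hneg
  · exact absurd hu (spectrum.mem_iff.mp hw)
  · have hsq : ‖1 + h * w‖ ^ 2 = 1 + h * (2 * w.re + h * ‖w‖ ^ 2) := by
      simp only [Complex.sq_norm, Complex.normSq_apply, Complex.add_re, Complex.add_im,
        Complex.mul_re, Complex.mul_im, Complex.one_re, Complex.one_im, Complex.ofReal_re,
        Complex.ofReal_im]
      ring
    have : ‖1 + h * w‖ ^ 2 < 1 := by rw [hsq]; nlinarith
    exact (sq_lt_one_iff₀ (norm_nonneg _)).mp this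

/-- A fixed point at which some power of the derivative is a strict contraction attracts all
nearby points. -/
theorem exists_isOpen_forall_tendsto_iterate {E : Type*} [NormedAddCommGroup E] [NormedSpace ℝ E]
    {f : E → E} {L : E →L[ℝ] E} {x : E} (hf : HasFDerivAt f L x) (hc : Continuous f)
    (hx : f x = x) {N : ℕ} (hN : 0 < N) (hL : ‖L ^ N‖ < 1) :
    ∃ U : Set E, IsOpen U ∧ x ∈ U ∧
      ∀ y ∈ U, Tendsto (fun k => f^[k] y) atTop (𝓝 x) := by
  obtain ⟨c, hLc, hc1⟩ := exists_between hL
  have hc0 : 0 ≤ c := (norm_nonneg _).trans hLc.le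
  have hfix : ∀ r, f^[r] x = x := fun r => Function.iterate_fixed hx r
  have hbound : ∀ᶠ y in 𝓝 x, ‖f^[N] y - x‖ ≤ c * ‖y - x‖ := by
    have hd := (hf.iterate hx N).isLittleO.def (sub_pos.mpr hLc)
    filter_upwards [hd] with y hy
    rw [hfix] at hy
    calc ‖f^[N] y - x‖ = ‖(f^[N] y - x - (L ^ N) (y - x)) + (L ^ N) (y - x)‖ := by
          rw [sub_add_cancel]
      _ ≤ (c - ‖L ^ N‖) * ‖y - x‖ + ‖L ^ N‖ * ‖y - x‖ :=
          (norm_add_le _ _).trans (add_le_add hy ((L ^ N).le_opNorm _))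
      _ = c * ‖y - x‖ := by ring
  obtain ⟨ε, hε, hball⟩ := Metric.eventually_nhds_iff_ball.mp hbound
  refine ⟨Metric.ball x ε, Metric.isOpen_ball, Metric.mem_ball_self hε, fun y hy => ?_⟩
  have hdecay : ∀ m, ‖(f^[N])^[m] y - x‖ ≤ c ^ m * ‖y - x‖ := by
    intro m
    induction m with
    | zero => simp
    | succ m ih =>
      have hmem : (f^[N])^[m] y ∈ Metric.ball x ε := by
        rw [mem_ball_iff_norm] at hy ⊢
        exact (ih.trans (mul_le_of_le_one_left (norm_nonneg _)
          (pow_le_one₀ hc0 hc1.le))).trans_lt hy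
      rw [Function.iterate_succ_apply', pow_succ', mul_assoc]
      exact (hball _ hmem).trans (mul_le_mul_of_nonneg_left ih hc0)
  have hsub : Tendsto (fun m => (f^[N])^[m] y) atTop (𝓝 x) := by
    rw [tendsto_iff_norm_sub_tendsto_zero]
    refine squeeze_zero (fun _ => norm_nonneg _) hdecay ?_
    simpa using (tendsto_pow_atTop_nhds_zero_of_lt_one hc0 hc1).mul_const ‖y - x‖
  refine tendsto_def.mpr fun V hV => ?_
  have hW : ∀ᶠ z in 𝓝 x, ∀ r ∈ Finset.range N, f^[r] z ∈ V := by
    refine (Finset.eventually_all _).mpr fun r _ => ?_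
    exact (hc.iterate r).continuousAt.eventually_mem (by rwa [hfix])
  filter_upwards [(hsub.comp (Nat.tendsto_div_const_atTop hN.ne')).eventually hW] with k hk
  have := hk (k % N) (Finset.mem_range.mpr (Nat.mod_lt _ hN))
  rwa [Function.comp_apply, ← Function.iterate_mul, ← Function.iterate_add_apply,
    Nat.mod_add_div] at this

attribute [local instance] Matrix.linftyOpNormedRing Matrix.linftyOpNormedAlgebra

/-- The `ℓ∞` operator norm of a real matrix bounds the operator norm on `ℝⁿ` with the sup norm, and
it is unchanged by extending scalars to `ℂ`. -/
theorem norm_mulVecLin_le_norm_map_ofReal {n : ℕ} (M : Matrix (Fin n) (Fin n) ℝ) :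
    ‖M.mulVecLin.toContinuousLinearMap‖ ≤ ‖M.map ((↑) : ℝ → ℂ)‖ := by
  have hM : ‖M.map ((↑) : ℝ → ℂ)‖ = ‖M‖ := by
    simp [Matrix.linfty_opNorm_def]
  rw [hM]
  exact ContinuousLinearMap.opNorm_le_bound _ (norm_nonneg _) fun v =>
    Matrix.linfty_opNorm_mulVec M v

/-- Local convergence of alternating gradient ascent: if `G₁(x̄) = G₂(x̄) = 0`
and all complex eigenvalues of `G₁′(x̄) + G₂′(x̄)` have negative real part, then
for all sufficiently small `h > 0` the composed iteration
`F = (id + h·G₂) ∘ (id + h·G₁)` is locally convergent to `x̄`. -/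
theorem alternating_locally_convergent {n : ℕ} (G₁ G₂ : (Fin n → ℝ) → (Fin n → ℝ))
    (hG₁ : ContDiff ℝ 1 G₁) (hG₂ : ContDiff ℝ 1 G₂) (xbar : Fin n → ℝ)
    (h1 : G₁ xbar = 0) (h2 : G₂ xbar = 0)
    (J₁ J₂ : Matrix (Fin n) (Fin n) ℝ)
    (hJ₁ : HasFDerivAt G₁ J₁.mulVecLin.toContinuousLinearMap xbar)
    (hJ₂ : HasFDerivAt G₂ J₂.mulVecLin.toContinuousLinearMap xbar)
    (heig : ∀ lam ∈ spectrum ℂ ((J₁ + J₂).map (Complex.ofReal ·)), lam.re < 0) :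
    ∃ h₀ > (0 : ℝ), ∀ h : ℝ, 0 < h → h < h₀ →
      ∃ U : Set (Fin n → ℝ), IsOpen U ∧ xbar ∈ U ∧
        ∀ x₀ ∈ U, Tendsto
          (fun k => ((fun x => x + h • G₂ x) ∘ (fun x => x + h • G₁ x))^[k] x₀)
          atTop (𝓝 xbar) := by
  have hcomplete : CompleteSpace (Matrix (Fin n) (Fin n) ℂ) := FiniteDimensional.complete ℂ _
  let toC : Matrix (Fin n) (Fin n) ℝ →+* Matrix (Fin n) (Fin n) ℂ := Complex.ofRealHom.mapMatrix
  have hev := eventually_spectrum_one_add_smul_norm_lt_one (toC (J₁ + J₂)) (toC (J₂ * J₁)) heig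
  obtain ⟨h₀, hh₀, hsub⟩ := mem_nhdsGT_iff_exists_Ioo_subset.mp hev
  refine ⟨h₀, hh₀, fun h hpos hlt => ?_⟩
  obtain ⟨N, hN, hnorm⟩ := exists_norm_pow_lt_one_of_spectrum _ (hsub ⟨hpos, hlt⟩)
  set M : Matrix (Fin n) (Fin n) ℝ := 1 + h • (J₁ + J₂ + h • (J₂ * J₁))
  have hsmul : ∀ K : Matrix (Fin n) (Fin n) ℝ, toC (h • K) = (h : ℂ) • toC K := fun K => by
    ext i j; simp [toC]
  have hMC : toC (M ^ N) =
      (1 + (h : ℂ) • (toC (J₁ + J₂) + (h : ℂ) • toC (J₂ * J₁))) ^ N := by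
    rw [map_pow, map_add, map_one, hsmul, map_add, hsmul]
  have hpow : M.mulVecLin.toContinuousLinearMap ^ N =
      (M ^ N).mulVecLin.toContinuousLinearMap := by
    have hL : ∀ K : Matrix (Fin n) (Fin n) ℝ, K.mulVecLin.toContinuousLinearMap =
        Module.End.toContinuousLinearMap (Fin n → ℝ) (Matrix.toLinAlgEquiv' K) := fun _ => rfl
    rw [hL, hL, map_pow, map_pow]
  have hlt1 : ‖M.mulVecLin.toContinuousLinearMap ^ N‖ < 1 := by
    rw [hpow]
    refine (norm_mulVecLin_le_norm_map_ofReal _).trans_lt ?_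
    rw [← hMC] at hnorm
    exact hnorm
  have hstep : (fun x => x + h • G₁ x) xbar = xbar := by simp [h1]
  have hd1 : HasFDerivAt (fun x => x + h • G₁ x)
      (.id ℝ _ + h • J₁.mulVecLin.toContinuousLinearMap) xbar :=
    (hasFDerivAt_id xbar).add (hJ₁.const_smul h)
  have hd2 : HasFDerivAt (fun x => x + h • G₂ x)
      (.id ℝ _ + h • J₂.mulVecLin.toContinuousLinearMap) xbar :=
    (hasFDerivAt_id xbar).add (hJ₂.const_smul h)
  have hd : HasFDerivAt ((fun x => x + h • G₂ x) ∘ (fun x => x + h • G₁ x))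
      M.mulVecLin.toContinuousLinearMap xbar := by
    refine (HasFDerivAt.comp xbar (hstep.symm ▸ hd2) hd1).congr_fderiv ?_
    refine ContinuousLinearMap.ext fun v => ?_
    simp [M, Matrix.mulVec_mulVec]
    abel
  have hc1 := hG₁.continuous
  have hc2 := hG₂.continuous
  exact exists_isOpen_forall_tendsto_iterate hd (by fun_prop) (by simp [h1, h2]) hN hlt1
end
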